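/- (Addition theorem for the Weierstrass ℘-function) Let τ be in the upper half plane ℍ and let z₁, z₂ ∈ ℂ with z₁ ∉ L_τ, z₂ ∉ L_τ and z₁ + z₂ ∉ L_τ, and suppose ℘_τ(z₁) ≠ ℘_τ(z₂). Then ℘_τ(z₁ + z₂) = −℘_τ(z₁) − ℘_τ(z₂) + (1/4) ( (℘′_τ(z₂) − ℘′_τ(z₁)) / (℘_τ(z₂) − ℘_τ(z₁)) )². -/

import Mathlib

/-- A lattice point mτ + n of the lattice L_τ = ℤ + ℤτ, indexed by (m, n) ∈ ℤ × ℤ. -/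
noncomputable def latPt (τ : ℂ) (p : ℤ × ℤ) : ℂ := (p.1 : ℂ) * τ + (p.2 : ℂ)

/-- The Weierstrass ℘-function
℘_τ(z) = 1/z² + Σ_{ω ∈ L_τ, ω ≠ 0} ( 1/(z−ω)² − 1/ω² ). -/
noncomputable def wp (τ z : ℂ) : ℂ :=
  1 / z ^ 2 + ∑' p : {p : ℤ × ℤ // p ≠ 0}, (1 / (z - latPt τ p.1) ^ 2 - 1 / latPt τ p.1 ^ 2)

/-- The derivative ℘′_τ(z) = −2 Σ_{ω ∈ L_τ} 1/(z−ω)³. -/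
noncomputable def wp' (τ z : ℂ) : ℂ := -2 * ∑' p : ℤ × ℤ, 1 / (z - latPt τ p) ^ 3

open Filter Topology
open scoped PeriodPair

theorem linearIndependent_pair_one {τ : ℂ} (hτ : 0 < τ.im) : LinearIndependent ℝ ![τ, 1] := by
  rw [LinearIndependent.pair_iff]
  intro s t h
  have h1 := congrArg Complex.im h
  have h2 := congrArg Complex.re h
  simp at h1 h2
  grind

/-- The period pair `(τ, 1)`, whose lattice is `ℤτ + ℤ`. -/
noncomputable def upperPeriodPair (τ : ℂ) (hτ : 0 < τ.im) : PeriodPair :=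
  ⟨τ, 1, linearIndependent_pair_one hτ⟩

theorem latticeEquivProd_symm_eq_latPt (τ : ℂ) (hτ : 0 < τ.im) (p : ℤ × ℤ) :
    ((upperPeriodPair τ hτ).latticeEquivProd.symm p : ℂ) = latPt τ p := by
  rw [PeriodPair.latticeEquiv_symm_apply]
  simp [upperPeriodPair, latPt]

theorem wp'_eq_derivWeierstrassP (τ : ℂ) (hτ : 0 < τ.im) (z : ℂ) :
    wp' τ z = (upperPeriodPair τ hτ).derivWeierstrassP z := by
  rw [wp', PeriodPair.derivWeierstrassP,
    ← (upperPeriodPair τ hτ).latticeEquivProd.symm.toEquiv.tsum_eq, ← tsum_mul_left, ← tsum_neg]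
  refine tsum_congr fun p ↦ ?_
  simp only [LinearEquiv.coe_toEquiv, latticeEquivProd_symm_eq_latPt]
  ring

theorem wp_eq_weierstrassP (τ : ℂ) (hτ : 0 < τ.im) (z : ℂ) :
    wp τ z = (upperPeriodPair τ hτ).weierstrassP z := by
  set L := upperPeriodPair τ hτ with hL
  rw [← L.weierstrassPExcept_add 0 z, wp, add_comm, PeriodPair.weierstrassPExcept,
    ← L.latticeEquivProd.symm.toEquiv.tsum_eq]
  congr 1
  · refine (tsum_subtype {p : ℤ × ℤ | p ≠ 0} fun p ↦
      1 / (z - latPt τ p) ^ 2 - 1 / latPt τ p ^ 2).trans (tsum_congr fun p ↦ ?_)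
    by_cases hp : p = 0
    · simp [hp]
    · rw [Set.indicator_of_mem (by exact hp), if_neg (by simpa using hp),
        ← latticeEquivProd_symm_eq_latPt τ hτ, ← hL, LinearEquiv.coe_toEquiv]
  · simp

theorem Set.Countable.isPreconnected_compl {s : Set ℂ} (hs : s.Countable) : IsPreconnected sᶜ :=
  (hs.isConnected_compl_of_one_lt_rank (by simp)).isPreconnected

namespace PeriodPair

variable (L : PeriodPair)

theorem countable_lattice : (L.lattice : Set ℂ).Countable :=
  countable_of_Lindelof_of_discrete (X := L.lattice)

theorem eventually_notMem_lattice : ∀ᶠ t in 𝓝[≠] (0 : ℂ), t ∉ L.lattice := by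
  filter_upwards [self_mem_nhdsWithin, mem_nhdsWithin_of_mem_nhds
    (L.compl_lattice_sdiff_singleton_mem_nhds 0)] with t ht ht'
  simp_all

theorem eventually_sub_notMem_lattice {c : ℂ} (hc : c ∉ L.lattice) :
    ∀ᶠ t in 𝓝[≠] (0 : ℂ), c - t ∉ L.lattice := by
  have hcont : ContinuousAt (fun t ↦ c - t) (0 : ℂ) := by fun_prop
  exact mem_nhdsWithin_of_mem_nhds (hcont.eventually_mem
    (L.isClosed_lattice.isOpen_compl.mem_nhds (by simpa using hc)))

theorem hasDerivAt_weierstrassP {z : ℂ} (hz : z ∉ L.lattice) :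
    HasDerivAt ℘[L] (℘'[L] z) z := by
  rw [← L.deriv_weierstrassP]
  exact (L.analyticOnNhd_weierstrassP z hz).differentiableAt.hasDerivAt

theorem exists_derivWeierstrassP_ne_zero : ∃ z ∉ L.lattice, ℘'[L] z ≠ 0 := by
  by_contra! h
  obtain ⟨t, ht⟩ := L.eventually_notMem_lattice.exists
  have hconst : ∀ᶠ z in 𝓝[≠] (0 : ℂ), ℘[L] z = ℘[L] t := by
    filter_upwards [L.eventually_notMem_lattice] with z hz
    refine L.isClosed_lattice.isOpen_compl.is_const_of_deriv_eq_zero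
      L.countable_lattice.isPreconnected_compl L.differentiableOn_weierstrassP ?_ hz ht
    intro w hw
    rw [L.deriv_weierstrassP]
    exact h w hw
  have h0 : meromorphicOrderAt ℘[L] 0 = meromorphicOrderAt (fun _ : ℂ ↦ ℘[L] t) 0 :=
    meromorphicOrderAt_congr hconst
  rw [L.order_weierstrassP 0 (zero_mem _), meromorphicOrderAt_const] at h0
  split_ifs at h0
  all_goals revert h0; decide

/-- The differential equation `℘'' = 6 ℘² - g₂ / 2`. -/
theorem hasDerivAt_derivWeierstrassP {z : ℂ} (hz : z ∉ L.lattice) :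
    HasDerivAt ℘'[L] (6 * ℘[L] z ^ 2 - L.g₂ / 2) z := by
  have hP := L.analyticOnNhd_weierstrassP
  have hP' := L.analyticOnNhd_derivWeierstrassP
  have key : ∀ w ∈ (L.lattice : Set ℂ)ᶜ,
      ℘'[L] w * (deriv ℘'[L] w - (6 * ℘[L] w ^ 2 - L.g₂ / 2)) = 0 := by
    intro w hw
    have h1 := L.hasDerivAt_weierstrassP hw
    have h2 := (hP' w hw).differentiableAt.hasDerivAt
    have h3 : (fun z ↦ ℘'[L] z ^ 2) =ᶠ[𝓝 w] fun z ↦ 4 * ℘[L] z ^ 3 - L.g₂ * ℘[L] z - L.g₃ := by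
      filter_upwards [L.isClosed_lattice.isOpen_compl.mem_nhds hw] with x hx
      exact L.derivWeierstrassP_sq x hx
    have h4 := (h2.fun_pow 2).unique
      (((((h1.fun_pow 3).const_mul 4).sub (h1.const_mul L.g₂)).sub_const L.g₃).congr_of_eventuallyEq
        h3)
    simp at h4
    linear_combination h4 / 2
  obtain h | h := hP'.eq_zero_or_eq_zero_of_mul_eq_zero
    (hP'.deriv.sub (((analyticOnNhd_const (v := (6 : ℂ))).mul (hP.pow 2)).sub
      (analyticOnNhd_const (v := L.g₂ / 2)))) key L.countable_lattice.isPreconnected_compl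
  · obtain ⟨w, hw, hw'⟩ := L.exists_derivWeierstrassP_ne_zero
    exact absurd (h w hw) hw'
  · exact (hP' z hz).differentiableAt.hasDerivAt.congr_deriv (sub_eq_zero.mp (h z hz))

/-- The right-hand side of the addition theorem for `℘`, at the points `t` and `c - t`. -/
noncomputable def additionChord (c t : ℂ) : ℂ :=
  1 / 4 * ((℘'[L] t - ℘'[L] (c - t)) / (℘[L] t - ℘[L] (c - t))) ^ 2 - ℘[L] t - ℘[L] (c - t)

theorem hasDerivAt_additionChord {c t : ℂ} (ht : t ∉ L.lattice) (hct : c - t ∉ L.lattice)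
    (hne : ℘[L] t ≠ ℘[L] (c - t)) : HasDerivAt (L.additionChord c) 0 t := by
  have hne' := sub_ne_zero.mpr hne
  have h0 : HasDerivAt (fun t ↦ c - t) (-1) t := by simpa using (hasDerivAt_id t).const_sub c
  have p1 := L.hasDerivAt_weierstrassP ht
  have p2 := L.hasDerivAt_derivWeierstrassP ht
  have q1 := (L.hasDerivAt_weierstrassP hct).comp t h0
  have q2 := (L.hasDerivAt_derivWeierstrassP hct).comp t h0
  have hs1 := L.derivWeierstrassP_sq t ht
  have hs2 := L.derivWeierstrassP_sq (c - t) hct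
  have hG := (((((p2.sub q2).fun_div (p1.sub q1) hne').fun_pow 2).const_mul (1 / 4)).sub p1).sub q1
  refine HasDerivAt.congr_deriv hG ?_
  simp only [Pi.sub_apply, Function.comp_apply]
  set p := ℘[L] t
  set q := ℘[L] (c - t)
  set p' := ℘'[L] t
  set q' := ℘'[L] (c - t)
  have hslope : (6 * p ^ 2 - L.g₂ / 2 - (6 * q ^ 2 - L.g₂ / 2) * -1) * (p - q) -
      (p' - q') * (p' - q' * -1) = 2 * (p - q) ^ 3 := by
    linear_combination hs2 - hs1
  rw [hslope]
  push_cast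
  field_simp
  ring

/-- The Laurent expansion at `0` of `additionChord` has no polar part. -/
theorem exists_analyticAt_additionChord {c : ℂ} (hc : c ∉ L.lattice) :
    ∃ H : ℂ → ℂ, AnalyticAt ℂ H 0 ∧ H 0 = ℘[L] c ∧
      ∀ᶠ t in 𝓝[≠] (0 : ℂ), ℘[L] t ≠ ℘[L] (c - t) ∧ L.additionChord c t = H t := by
  have hq : AnalyticAt ℂ (fun t ↦ ℘[L] (c - t)) 0 :=
    AnalyticAt.fun_comp (by simpa using L.analyticOnNhd_weierstrassP c hc) (by fun_prop)
  have hq' : AnalyticAt ℂ (fun t ↦ ℘'[L] (c - t)) 0 :=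
    AnalyticAt.fun_comp (by simpa using L.analyticOnNhd_derivWeierstrassP c hc) (by fun_prop)
  have hA := L.analyticAt_weierstrassPExcept 0
  have hA' := L.analyticAt_derivWeierstrassPExcept 0
  have hA0 : ℘[L - (0 : ℂ)] 0 = 0 := by simp [weierstrassPExcept]
  let D : ℂ → ℂ := fun t ↦ ℘[L - (0 : ℂ)] t - ℘[L] (c - t)
  let B : ℂ → ℂ := fun t ↦ ℘'[L - (0 : ℂ)] t - ℘'[L] (c - t)
  have hD : AnalyticAt ℂ D 0 := hA.sub hq
  have hB : AnalyticAt ℂ B 0 := hA'.sub hq'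
  have hden : ∀ᶠ t in 𝓝 (0 : ℂ), 1 + t ^ 2 * D t ≠ 0 := by
    have : AnalyticAt ℂ (fun t ↦ 1 + t ^ 2 * D t) 0 := by fun_prop
    exact this.continuousAt.eventually_ne (by simp)
  refine ⟨fun t ↦ (-t * B t + t ^ 4 * B t ^ 2 / 4 - 2 * D t - t ^ 2 * D t ^ 2) /
    (1 + t ^ 2 * D t) ^ 2 - ℘[L - (0 : ℂ)] t - ℘[L] (c - t), ?_, ?_, ?_⟩
  · have : AnalyticAt ℂ (fun t ↦ (-t * B t + t ^ 4 * B t ^ 2 / 4 - 2 * D t - t ^ 2 * D t ^ 2) /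
        (1 + t ^ 2 * D t) ^ 2) 0 := by
      refine AnalyticAt.fun_div (by fun_prop) (by fun_prop) (by simp)
    exact (this.sub hA).sub hq
  · simp [D, hA0]
    ring
  · filter_upwards [self_mem_nhdsWithin, mem_nhdsWithin_of_mem_nhds hden] with t ht hden
    have ht : t ≠ 0 := ht
    have hP := L.weierstrassPExcept_def 0 t
    have hP' := L.derivWeierstrassPExcept_def 0 t
    simp only [ZeroMemClass.coe_zero, sub_zero] at hP hP'
    have h1 : ℘[L] t - ℘[L] (c - t) = (1 + t ^ 2 * D t) / t ^ 2 := by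
      simp only [D, hP]; field_simp; simp; ring
    have h2 : ℘'[L] t - ℘'[L] (c - t) = (-2 + t ^ 3 * B t) / t ^ 3 := by
      simp only [B, hP']; field_simp; ring
    have h3 : ℘[L] t = ℘[L - (0 : ℂ)] t + 1 / t ^ 2 := by
      rw [hP]; simp
    refine ⟨sub_ne_zero.mp ?_, ?_⟩
    · rw [h1]; positivity
    · rw [additionChord, h1, h2, h3]
      generalize D t = d at *
      generalize B t = b at *
      field_simp
      ring

theorem additionChord_eventually_eq {c : ℂ} (hc : c ∉ L.lattice) :
    ∀ᶠ t in 𝓝[≠] (0 : ℂ), ℘[L] t ≠ ℘[L] (c - t) ∧ L.additionChord c t = ℘[L] c := by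
  obtain ⟨H, hH, hH0, h⟩ := L.exists_analyticAt_additionChord hc
  have hderiv : ∀ᶠ t in 𝓝[≠] (0 : ℂ), deriv H t = 0 := by
    have h' := (eventually_nhdsWithin_eventually_nhds_iff_of_isOpen isOpen_compl_singleton).mpr h
    filter_upwards [h', h, L.eventually_notMem_lattice,
      L.eventually_sub_notMem_lattice hc] with t h' h ht hct
    rw [← EventuallyEq.deriv_eq (h'.mono fun s hs ↦ hs.2)]
    exact (L.hasDerivAt_additionChord ht hct h.1).deriv
  have hderiv' := hH.deriv.frequently_zero_iff_eventually_zero.mp hderiv.frequently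
  obtain ⟨r, hr, hball⟩ := Metric.eventually_nhds_iff_ball.mp
    (hderiv'.and hH.eventually_analyticAt)
  filter_upwards [h, mem_nhdsWithin_of_mem_nhds (Metric.ball_mem_nhds 0 hr)] with t ht htr
  refine ⟨ht.1, ht.2.trans ?_⟩
  rw [← hH0]
  exact Metric.isOpen_ball.is_const_of_deriv_eq_zero (convex_ball _ _).isPreconnected
    (fun s hs ↦ (hball s hs).2.differentiableAt.differentiableWithinAt)
    (fun s hs ↦ (hball s hs).1) htr (Metric.mem_ball_self hr)

theorem weierstrassP_add {z₁ z₂ : ℂ} (h₁ : z₁ ∉ L.lattice) (h₂ : z₂ ∉ L.lattice)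
    (h₁₂ : z₁ + z₂ ∉ L.lattice) (hne : ℘[L] z₁ ≠ ℘[L] z₂) :
    ℘[L] (z₁ + z₂) = -℘[L] z₁ - ℘[L] z₂ +
      (1 / 4) * ((℘'[L] z₂ - ℘'[L] z₁) / (℘[L] z₂ - ℘[L] z₁)) ^ 2 := by
  set c := z₁ + z₂ with hc
  let U : Set ℂ := (L.lattice ∪ (fun t ↦ c - t) ⁻¹' L.lattice)ᶜ
  have hU : IsPreconnected U := by
    refine (L.countable_lattice.union ?_).isPreconnected_compl
    exact L.countable_lattice.preimage_of_injOn (sub_right_injective.injOn)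
  let K : ℂ → ℂ := fun t ↦ (℘'[L] t - ℘'[L] (c - t)) ^ 2 -
    4 * (℘[L] c + ℘[L] t + ℘[L] (c - t)) * (℘[L] t - ℘[L] (c - t)) ^ 2
  have hK : AnalyticOnNhd ℂ K U := by
    intro t ht
    simp only [U, Set.mem_compl_iff, Set.mem_union, not_or] at ht
    have p := L.analyticOnNhd_weierstrassP t ht.1
    have p' := L.analyticOnNhd_derivWeierstrassP t ht.1
    have q : AnalyticAt ℂ (fun t ↦ ℘[L] (c - t)) t :=
      AnalyticAt.fun_comp (L.analyticOnNhd_weierstrassP (c - t) ht.2) (by fun_prop)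
    have q' : AnalyticAt ℂ (fun t ↦ ℘'[L] (c - t)) t :=
      AnalyticAt.fun_comp (L.analyticOnNhd_derivWeierstrassP (c - t) ht.2) (by fun_prop)
    fun_prop
  have hK0 : ∀ᶠ t in 𝓝[≠] (0 : ℂ), K t = 0 := by
    filter_upwards [L.additionChord_eventually_eq h₁₂] with t ht
    have hsub := sub_ne_zero.mpr ht.1
    simp only [K, ← ht.2, additionChord]
    field_simp
    ring
  have hKt := (eventually_nhdsWithin_eventually_nhds_iff_of_isOpen isOpen_compl_singleton).mpr hK0
  obtain ⟨t, hKt, ht, hct⟩ := (hKt.and (L.eventually_notMem_lattice.and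
    (L.eventually_sub_notMem_lattice h₁₂))).exists
  have hz : K z₁ = 0 := hK.eqOn_zero_of_preconnected_of_eventuallyEq_zero hU (z₀ := t)
    (by simp [U, ht, hct]) hKt (by simp [U, h₁, h₂, hc])
  have hsub := sub_ne_zero.mpr hne.symm
  simp only [K, show c - z₁ = z₂ by simp [hc]] at hz
  field_simp
  linear_combination -hz

end PeriodPair

/-- (Addition theorem for ℘) For τ in the upper half plane and z₁, z₂ with
z₁, z₂, z₁ + z₂ ∉ L_τ and ℘_τ(z₁) ≠ ℘_τ(z₂),
℘_τ(z₁ + z₂) = −℘_τ(z₁) − ℘_τ(z₂) + (1/4)((℘′_τ(z₂) − ℘′_τ(z₁))/(℘_τ(z₂) − ℘_τ(z₁)))². -/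
theorem wp_addition_theorem (τ : ℂ) (hτ : 0 < τ.im) (z₁ z₂ : ℂ)
    (hz₁ : ∀ m n : ℤ, z₁ ≠ (m : ℂ) * τ + (n : ℂ))
    (hz₂ : ∀ m n : ℤ, z₂ ≠ (m : ℂ) * τ + (n : ℂ))
    (hz₁₂ : ∀ m n : ℤ, z₁ + z₂ ≠ (m : ℂ) * τ + (n : ℂ))
    (hne : wp τ z₁ ≠ wp τ z₂) :
    wp τ (z₁ + z₂) =
      -wp τ z₁ - wp τ z₂ +
        (1 / 4) * ((wp' τ z₂ - wp' τ z₁) / (wp τ z₂ - wp τ z₁)) ^ 2 := by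
  have hmem : ∀ z : ℂ, (∀ m n : ℤ, z ≠ (m : ℂ) * τ + (n : ℂ)) →
      z ∉ (upperPeriodPair τ hτ).lattice := by
    intro z hz hmem
    obtain ⟨m, n, h⟩ := PeriodPair.mem_lattice.mp hmem
    exact hz m n (by simpa [upperPeriodPair] using h.symm)
  simp only [wp_eq_weierstrassP τ hτ, wp'_eq_derivWeierstrassP τ hτ] at hne ⊢
  exact PeriodPair.weierstrassP_add _ (hmem _ hz₁) (hmem _ hz₂) (hmem _ hz₁₂) hne
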